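/- arXiv:1410.7907 — 2 statements merged into one kernel-verified Lean document; each statement's English description precedes it below -/
import Mathlib

section
/- For the meridian surface M², the second fundamental form satisfies: ⟨h(x,x), n₁⟩ = 0, ⟨h(x,y), n₁⟩ = 0, ⟨h(y,y), n₁⟩ = κ/f, ⟨h(x,x), n₂⟩ = κ_α, ⟨h(x,y), n₂⟩ = 0, ⟨h(y,y), n₂⟩ = g'/f. Equivalently, with respect to the basis {x, y} the shape operators are A_{n₁} = diag(0, κ/f) and A_{n₂} = diag(κ_α, g'/f). -/
open Matrix

noncomputable section

/-- The embedding of `ℝ³ = span{e₁,e₂,e₃}` into `ℝ⁴`. -/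
def emb (p : Fin 3 → ℝ) : Fin 4 → ℝ := ![p 0, p 1, p 2, 0]

/-- The fourth standard basis vector `e₄` of `ℝ⁴`. -/
def e4 : Fin 4 → ℝ := ![0, 0, 0, 1]

/-- Model of the bivector `a ∧ b ∈ Λ²ℝ⁴` as the antisymmetric matrix `aᵢbⱼ − aⱼbᵢ`. -/
def wedge (a b : Fin 4 → ℝ) : Fin 4 → Fin 4 → ℝ := fun i j => a i * b j - a j * b i

/-- The tangent `t = r'` of the spherical curve `r`. -/
def sphT (r : ℝ → Fin 3 → ℝ) : ℝ → Fin 3 → ℝ := deriv r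

/-- The normal `n = r × t` of the spherical curve `r`. -/
def sphN (r : ℝ → Fin 3 → ℝ) (v : ℝ) : Fin 3 → ℝ := crossProduct (r v) (deriv r v)

/-- The spherical curvature `κ = ⟨t', n⟩` of the spherical curve `r`. -/
def sphCurv (r : ℝ → Fin 3 → ℝ) (v : ℝ) : ℝ := deriv (deriv r) v ⬝ᵥ sphN r v

/-- The curvature `κ_α = f′g″ − g′f″` of the meridian curve `α = (f, g)`. -/
def merCurv (f g : ℝ → ℝ) (u : ℝ) : ℝ :=
  deriv f u * deriv (deriv g) u - deriv g u * deriv (deriv f) u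

/-- The parametrization `z(u,v) = f(u) r(v) + g(u) e₄` of the meridian surface `M²`. -/
def mz (f g : ℝ → ℝ) (r : ℝ → Fin 3 → ℝ) (u v : ℝ) : Fin 4 → ℝ :=
  f u • emb (r v) + g u • e4

/-- The tangent frame vector `x = ∂z/∂u = f′ r + g′ e₄`. -/
def mx (f g : ℝ → ℝ) (r : ℝ → Fin 3 → ℝ) (u v : ℝ) : Fin 4 → ℝ :=
  deriv f u • emb (r v) + deriv g u • e4

/-- The tangent frame vector `y = (1/f) ∂z/∂v = t`. -/
def my (r : ℝ → Fin 3 → ℝ) (v : ℝ) : Fin 4 → ℝ := emb (deriv r v)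

/-- The normal frame vector `n₁ = n`. -/
def mn1 (r : ℝ → Fin 3 → ℝ) (v : ℝ) : Fin 4 → ℝ := emb (sphN r v)

/-- The normal frame vector `n₂ = −g′ r + f′ e₄`. -/
def mn2 (f g : ℝ → ℝ) (r : ℝ → Fin 3 → ℝ) (u v : ℝ) : Fin 4 → ℝ :=
  (-(deriv g u)) • emb (r v) + deriv f u • e4

/-- The Gauss map `G = x ∧ y` of the meridian surface, with values in `Λ²ℝ⁴`. -/
def gaussG (f g : ℝ → ℝ) (r : ℝ → Fin 3 → ℝ) (u v : ℝ) : Fin 4 → Fin 4 → ℝ :=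
  wedge (mx f g r u v) (my r v)

/-- The Laplacian `Δφ = −(∂²φ/∂u² + (1/f²) ∂²φ/∂v² + (f′/f) ∂φ/∂u)` of the meridian
surface, acting on `Λ²ℝ⁴`-valued functions. -/
def surfLap (f : ℝ → ℝ) (φ : ℝ → ℝ → Fin 4 → Fin 4 → ℝ) (u v : ℝ) : Fin 4 → Fin 4 → ℝ :=
  -(deriv (deriv (fun s => φ s v)) u + (1 / f u ^ 2) • deriv (deriv (fun s => φ u s)) v
    + (deriv f u / f u) • deriv (fun s => φ s v) u)

/-- `h(x,x)`: the normal component (w.r.t. `{n₁, n₂}`) of `∇′ₓx = ∂x/∂u`. -/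
def hxx (f g : ℝ → ℝ) (r : ℝ → Fin 3 → ℝ) (u v : ℝ) : Fin 4 → ℝ :=
  (deriv (fun s => mx f g r s v) u ⬝ᵥ mn1 r v) • mn1 r v
    + (deriv (fun s => mx f g r s v) u ⬝ᵥ mn2 f g r u v) • mn2 f g r u v

/-- `h(x,y)`: the normal component (w.r.t. `{n₁, n₂}`) of `∇′_y x = (1/f) ∂x/∂v`. -/
def hxy (f g : ℝ → ℝ) (r : ℝ → Fin 3 → ℝ) (u v : ℝ) : Fin 4 → ℝ :=
  (((1 / f u) • deriv (fun s => mx f g r u s) v) ⬝ᵥ mn1 r v) • mn1 r v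
    + (((1 / f u) • deriv (fun s => mx f g r u s) v) ⬝ᵥ mn2 f g r u v) • mn2 f g r u v

/-- `h(y,y)`: the normal component (w.r.t. `{n₁, n₂}`) of `∇′_y y = (1/f) ∂y/∂v`. -/
def hyy (f g : ℝ → ℝ) (r : ℝ → Fin 3 → ℝ) (u v : ℝ) : Fin 4 → ℝ :=
  (((1 / f u) • deriv (my r) v) ⬝ᵥ mn1 r v) • mn1 r v
    + (((1 / f u) • deriv (my r) v) ⬝ᵥ mn2 f g r u v) • mn2 f g r u v


theorem emb_dotProduct_emb (p q : Fin 3 → ℝ) : emb p ⬝ᵥ emb q = p ⬝ᵥ q := by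
  simp [emb, dotProduct, Fin.sum_univ_succ]

theorem emb_dotProduct_e4 (p : Fin 3 → ℝ) : emb p ⬝ᵥ e4 = 0 := by
  simp [emb, e4, dotProduct, Fin.sum_univ_succ]

theorem e4_dotProduct_emb (p : Fin 3 → ℝ) : e4 ⬝ᵥ emb p = 0 := by
  rw [dotProduct_comm, emb_dotProduct_e4]

theorem e4_dotProduct_e4 : e4 ⬝ᵥ e4 = 1 := by
  simp [e4, dotProduct, Fin.sum_univ_succ]

theorem HasDerivAt.emb {r : ℝ → Fin 3 → ℝ} {r' : Fin 3 → ℝ} {v : ℝ} (h : HasDerivAt r r' v) :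
    HasDerivAt (fun s => _root_.emb (r s)) (_root_.emb r') v := by
  rw [hasDerivAt_pi] at h ⊢
  intro i
  fin_cases i
  · exact h 0
  · exact h 1
  · exact h 2
  · exact hasDerivAt_const v (0 : ℝ)

theorem HasDerivAt.dotProduct {ι : Type*} [Fintype ι] {a b : ℝ → ι → ℝ} {a' b' : ι → ℝ} {v : ℝ}
    (ha : HasDerivAt a a' v) (hb : HasDerivAt b b' v) :
    HasDerivAt (fun s => a s ⬝ᵥ b s) (a' ⬝ᵥ b v + a v ⬝ᵥ b') v := by
  rw [hasDerivAt_pi] at ha hb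
  simp only [_root_.dotProduct, ← Finset.sum_add_distrib]
  exact HasDerivAt.fun_sum fun i _ => (ha i).mul (hb i)

/-- On an open set, a smooth function and its derivative are differentiable. -/
theorem ContDiffOn.hasDerivAt_and_hasDerivAt_deriv {E : Type*} [NormedAddCommGroup E]
    [NormedSpace ℝ E] {φ : ℝ → E} {s : Set ℝ} (hφ : ContDiffOn ℝ (⊤ : ℕ∞) φ s) (hs : IsOpen s)
    {x : ℝ} (hx : x ∈ s) :
    HasDerivAt φ (deriv φ x) x ∧ HasDerivAt (deriv φ) (deriv (deriv φ) x) x := by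
  have h := (contDiffOn_infty_iff_deriv_of_isOpen hs).1 hφ
  exact ⟨(h.1.differentiableAt (hs.mem_nhds hx)).hasDerivAt,
    ((h.2.differentiableOn (by simp)).differentiableAt (hs.mem_nhds hx)).hasDerivAt⟩

/-- If `⟨a, b⟩` is constant on an open set, then `⟨a', b⟩ + ⟨a, b'⟩ = 0` there. -/
theorem dotProduct_deriv_add_eq_zero {ι : Type*} [Fintype ι] {a b : ℝ → ι → ℝ} {a' b' : ι → ℝ}
    {s : Set ℝ} (hs : IsOpen s) {v c : ℝ} (hv : v ∈ s) (ha : HasDerivAt a a' v)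
    (hb : HasDerivAt b b' v) (hc : ∀ w ∈ s, a w ⬝ᵥ b w = c) :
    a' ⬝ᵥ b v + a v ⬝ᵥ b' = 0 :=
  (ha.dotProduct hb).unique <| (hasDerivAt_const v c).congr_of_eventuallyEq <|
    Filter.eventually_of_mem (hs.mem_nhds hv) hc

/-- The second fundamental form of the meridian surface:
`⟨h(x,x), n₁⟩ = 0`, `⟨h(x,y), n₁⟩ = 0`, `⟨h(y,y), n₁⟩ = κ/f`,
`⟨h(x,x), n₂⟩ = κ_α`, `⟨h(x,y), n₂⟩ = 0`, `⟨h(y,y), n₂⟩ = g′/f`; equivalently the shape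
operators are `A_{n₁} = diag(0, κ/f)` and `A_{n₂} = diag(κ_α, g′/f)`. -/
theorem meridian_surface_second_fundamental_form
    (I J : Set ℝ) (hI : IsOpen I) (hIiv : I.OrdConnected) (hIne : I.Nonempty)
    (hJ : IsOpen J) (hJiv : J.OrdConnected) (hJne : J.Nonempty)
    (r : ℝ → Fin 3 → ℝ) (hr : ContDiffOn ℝ (⊤ : ℕ∞) r J)
    (hrs : ∀ v ∈ J, r v ⬝ᵥ r v = 1) (hra : ∀ v ∈ J, deriv r v ⬝ᵥ deriv r v = 1)
    (f g : ℝ → ℝ) (hf : ContDiffOn ℝ (⊤ : ℕ∞) f I) (hg : ContDiffOn ℝ (⊤ : ℕ∞) g I)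
    (hf0 : ∀ u ∈ I, f u ≠ 0) (hfg : ∀ u ∈ I, deriv f u ^ 2 + deriv g u ^ 2 = 1) :
    ∀ u ∈ I, ∀ v ∈ J,
      deriv (fun s => mx f g r s v) u ⬝ᵥ mn1 r v = 0 ∧
      ((1 / f u) • deriv (fun s => mx f g r u s) v) ⬝ᵥ mn1 r v = 0 ∧
      ((1 / f u) • deriv (my r) v) ⬝ᵥ mn1 r v = sphCurv r v / f u ∧
      deriv (fun s => mx f g r s v) u ⬝ᵥ mn2 f g r u v = merCurv f g u ∧
      ((1 / f u) • deriv (fun s => mx f g r u s) v) ⬝ᵥ mn2 f g r u v = 0 ∧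
      ((1 / f u) • deriv (my r) v) ⬝ᵥ mn2 f g r u v = deriv g u / f u := by
  have htr : ∀ w ∈ J, deriv r w ⬝ᵥ r w = 0 := fun w hw => by
    have h := (hr.hasDerivAt_and_hasDerivAt_deriv hJ hw).1
    have h0 := dotProduct_deriv_add_eq_zero hJ hw h h hrs
    rw [dotProduct_comm (r w)] at h0
    linarith
  intro u hu v hv
  obtain ⟨hr1, hr2⟩ := hr.hasDerivAt_and_hasDerivAt_deriv hJ hv
  have hf2 := (hf.hasDerivAt_and_hasDerivAt_deriv hI hu).2
  have hg2 := (hg.hasDerivAt_and_hasDerivAt_deriv hI hu).2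
  have hrr : deriv (deriv r) v ⬝ᵥ r v = -1 := by
    have h0 := dotProduct_deriv_add_eq_zero hJ hv hr2 hr1 htr
    linarith [hra v hv]
  have hxu : deriv (fun s => mx f g r s v) u
      = deriv (deriv f) u • emb (r v) + deriv (deriv g) u • e4 :=
    ((hf2.smul_const _).add (hg2.smul_const _)).deriv
  have hxv : deriv (fun s => mx f g r u s) v = deriv f u • emb (deriv r v) :=
    ((hr1.emb.const_smul (deriv f u)).add_const (deriv g u • e4)).deriv
  have hyv : deriv (my r) v = emb (deriv (deriv r) v) := hr2.emb.deriv
  have hrn : r v ⬝ᵥ sphN r v = 0 := dot_self_cross _ _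
  have htn : deriv r v ⬝ᵥ sphN r v = 0 := dot_cross_self _ _
  rw [hxu, hxv, hyv]
  simp only [mn1, mn2, sphCurv, merCurv, add_dotProduct, dotProduct_add, smul_dotProduct,
    dotProduct_smul, smul_eq_mul, emb_dotProduct_emb, emb_dotProduct_e4, e4_dotProduct_emb,
    e4_dotProduct_e4, hrn, htn, hrs v hv, htr v hv, hrr]
  refine ⟨?_, ?_, ?_, ?_, ?_, ?_⟩ <;> ring
end
end

section
/- Suppose g' ≡ 0 on I. Then there is no smooth nowhere-zero function λ on I × J such that ΔG = λ G; that is, in the case g' ≡ 0 there are no meridian surfaces with pointwise 1-type Gauss map of the first kind. -/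
open Matrix

noncomputable section

/-- The bivector `r ∧ r'` of a curve in `ℝ³`, viewed in `Λ²ℝ⁴`. -/
def tangentWedge (r : ℝ → Fin 3 → ℝ) (v : ℝ) : Fin 4 → Fin 4 → ℝ :=
  wedge (emb (r v)) (emb (deriv r v))

lemma hasDerivAt_emb {a : ℝ → Fin 3 → ℝ} {a' : Fin 3 → ℝ} {v : ℝ} (ha : HasDerivAt a a' v) :
    HasDerivAt (fun s => emb (a s)) (emb a') v := by
  have h := hasDerivAt_pi.1 ha
  refine hasDerivAt_pi.2 fun i => ?_
  fin_cases i
  · exact h 0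
  · exact h 1
  · exact h 2
  · exact hasDerivAt_const v 0

lemma hasDerivAt_wedge {a b : ℝ → Fin 4 → ℝ} {a' b' : Fin 4 → ℝ} {v : ℝ}
    (ha : HasDerivAt a a' v) (hb : HasDerivAt b b' v) :
    HasDerivAt (fun s => wedge (a s) (b s)) (wedge a' (b v) + wedge (a v) b') v := by
  refine hasDerivAt_pi.2 fun i => hasDerivAt_pi.2 fun j => ?_
  have hi := (hasDerivAt_pi.1 ha i).mul (hasDerivAt_pi.1 hb j)
  have hj := (hasDerivAt_pi.1 ha j).mul (hasDerivAt_pi.1 hb i)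
  refine (hi.sub hj).congr_deriv ?_
  simp only [wedge, Pi.add_apply]
  ring

lemma hasDerivAt_dotProduct {a b : ℝ → Fin 3 → ℝ} {a' b' : Fin 3 → ℝ} {v : ℝ}
    (ha : HasDerivAt a a' v) (hb : HasDerivAt b b' v) :
    HasDerivAt (fun s => a s ⬝ᵥ b s) (a' ⬝ᵥ b v + a v ⬝ᵥ b') v := by
  simp only [dotProduct, ← Finset.sum_add_distrib]
  exact HasDerivAt.fun_sum fun i _ => (hasDerivAt_pi.1 ha i).mul (hasDerivAt_pi.1 hb i)

lemma wedge_self (a : Fin 4 → ℝ) : wedge a a = 0 := by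
  ext i j
  simp [wedge, mul_comm]

lemma hasDerivAt_deriv_of_contDiffOn {E : Type*} [NormedAddCommGroup E] [NormedSpace ℝ E]
    {a : ℝ → E} {J : Set ℝ} (hJ : IsOpen J) (ha : ContDiffOn ℝ (⊤ : ℕ∞) a J)
    {v : ℝ} (hv : v ∈ J) : HasDerivAt a (deriv a v) v :=
  ((ha.differentiableOn (by simp)).differentiableAt (hJ.mem_nhds hv)).hasDerivAt

lemma hasDerivAt_zero_of_eqOn_const {a : ℝ → ℝ} {a' c : ℝ} {J : Set ℝ} (hJ : IsOpen J)
    (hc : ∀ v ∈ J, a v = c) {v : ℝ} (hv : v ∈ J) (ha : HasDerivAt a a' v) : a' = 0 :=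
  ha.unique ((hasDerivAt_const v c).congr_of_eventuallyEq
    (Filter.eventually_of_mem (hJ.mem_nhds hv) hc))

lemma wedge_emb_ne_zero {a b : Fin 3 → ℝ} (ha : a ⬝ᵥ a = 1) (hb : b ⬝ᵥ b = 1)
    (hab : a ⬝ᵥ b = 0) : wedge (emb a) (emb b) ≠ 0 := by
  intro h
  have h01 := congrFun (congrFun h 0) 1
  have h02 := congrFun (congrFun h 0) 2
  have h12 := congrFun (congrFun h 1) 2
  simp only [wedge, emb, dotProduct, Fin.sum_univ_three, Pi.zero_apply, cons_val] at *
  have : (1 : ℝ) = 0 := by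
    linear_combination (-1) * ha - (a 0 * a 0 + a 1 * a 1 + a 2 * a 2) * hb
      + (a 0 * b 0 + a 1 * b 1 + a 2 * b 2) * hab
      + (a 0 * b 1 - a 1 * b 0) * h01 + (a 0 * b 2 - a 2 * b 0) * h02
      + (a 1 * b 2 - a 2 * b 1) * h12
  exact one_ne_zero this

/-- If `r, t` are orthonormal and `t ∧ q + r ∧ p` is proportional to `r ∧ t`, then `q` has no
component along `r × t`; with its components along `r` and `t` known, `q = -r`. -/
lemma eq_neg_of_wedge_eq_smul {r t q p : Fin 3 → ℝ} {m : ℝ}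
    (hrr : r ⬝ᵥ r = 1) (htt : t ⬝ᵥ t = 1) (hrt : r ⬝ᵥ t = 0)
    (hrq : r ⬝ᵥ q = -1) (htq : t ⬝ᵥ q = 0)
    (h : wedge (emb t) (emb q) + wedge (emb r) (emb p) = m • wedge (emb r) (emb t)) :
    q = -r := by
  have h01 := congrFun (congrFun h 0) 1
  have h02 := congrFun (congrFun h 0) 2
  have h12 := congrFun (congrFun h 1) 2
  simp only [wedge, emb, dotProduct, Fin.sum_univ_three, Pi.add_apply, Pi.smul_apply, smul_eq_mul,
    cons_val] at *
  have hdet : r 0 * (t 1 * q 2 - t 2 * q 1) - r 1 * (t 0 * q 2 - t 2 * q 0)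
      + r 2 * (t 0 * q 1 - t 1 * q 0) = 0 := by
    linear_combination r 0 * h12 - r 1 * h02 + r 2 * h01
  obtain ⟨w, hw⟩ : ∃ w : Fin 3 → ℝ, w = q + r := ⟨_, rfl⟩
  have hq : ∀ i, q i = w i - r i := fun i => by simp [hw]
  simp only [hq] at hrq htq hdet
  have hwr : r 0 * w 0 + r 1 * w 1 + r 2 * w 2 = 0 := by linear_combination hrq + hrr
  have hwt : t 0 * w 0 + t 1 * w 1 + t 2 * w 2 = 0 := by linear_combination htq + hrt
  have hwn : w 0 * (r 1 * t 2 - r 2 * t 1) - w 1 * (r 0 * t 2 - r 2 * t 0)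
      + w 2 * (r 0 * t 1 - r 1 * t 0) = 0 := by linear_combination hdet
  have hn : (r 1 * t 2 - r 2 * t 1) ^ 2 + (r 0 * t 2 - r 2 * t 0) ^ 2
      + (r 0 * t 1 - r 1 * t 0) ^ 2 = 1 := by
    linear_combination hrr + (r 0 * r 0 + r 1 * r 1 + r 2 * r 2) * htt
      - (r 0 * t 0 + r 1 * t 1 + r 2 * t 2) * hrt
  have hcross (i : Fin 3) : r i * (t 0 * w 0 + t 1 * w 1 + t 2 * w 2)
      - t i * (r 0 * w 0 + r 1 * w 1 + r 2 * w 2) = 0 := by rw [hwr, hwt]; ring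
  have hsq : w 0 ^ 2 + w 1 ^ 2 + w 2 ^ 2 = 0 := by
    have hl : (w 0 ^ 2 + w 1 ^ 2 + w 2 ^ 2) * ((r 1 * t 2 - r 2 * t 1) ^ 2
        + (r 0 * t 2 - r 2 * t 0) ^ 2 + (r 0 * t 1 - r 1 * t 0) ^ 2)
        = (w 0 * (r 1 * t 2 - r 2 * t 1) - w 1 * (r 0 * t 2 - r 2 * t 0)
          + w 2 * (r 0 * t 1 - r 1 * t 0)) ^ 2
        + (r 0 * (t 0 * w 0 + t 1 * w 1 + t 2 * w 2)
          - t 0 * (r 0 * w 0 + r 1 * w 1 + r 2 * w 2)) ^ 2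
        + (r 1 * (t 0 * w 0 + t 1 * w 1 + t 2 * w 2)
          - t 1 * (r 0 * w 0 + r 1 * w 1 + r 2 * w 2)) ^ 2
        + (r 2 * (t 0 * w 0 + t 1 * w 1 + t 2 * w 2)
          - t 2 * (r 0 * w 0 + r 1 * w 1 + r 2 * w 2)) ^ 2 := by ring
    rw [hn, hwn, hcross, hcross, hcross] at hl
    linarith
  have hz : ∀ i, w i = 0 := by
    have h0 := sq_nonneg (w 0)
    have h1 := sq_nonneg (w 1)
    have h2 := sq_nonneg (w 2)
    refine Fin.forall_fin_succ.2 ⟨?_, Fin.forall_fin_two.2 ⟨?_, ?_⟩⟩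
    · exact pow_eq_zero_iff two_ne_zero |>.1 (by linarith : w 0 ^ 2 = 0)
    · exact pow_eq_zero_iff two_ne_zero |>.1 (by linarith : w 1 ^ 2 = 0)
    · exact pow_eq_zero_iff two_ne_zero |>.1 (by linarith : w 2 ^ 2 = 0)
  ext i
  simp [hq, hz]

/-- For a unit speed spherical curve, `(r ∧ r')″` is a multiple of `r ∧ r'` only with factor
zero. -/
lemma factor_eq_zero_of_deriv_deriv_tangentWedge {J : Set ℝ} (hJ : IsOpen J)
    {r : ℝ → Fin 3 → ℝ} (hr : ContDiffOn ℝ (⊤ : ℕ∞) r J)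
    (hrs : ∀ v ∈ J, r v ⬝ᵥ r v = 1) (hra : ∀ v ∈ J, deriv r v ⬝ᵥ deriv r v = 1)
    {m : ℝ → ℝ} (hm : ∀ v ∈ J, deriv (deriv (tangentWedge r)) v = m v • tangentWedge r v)
    {v : ℝ} (hv : v ∈ J) : m v = 0 := by
  have hr1 : ContDiffOn ℝ (⊤ : ℕ∞) (deriv r) J := hr.deriv_of_isOpen hJ (by simp)
  have hr2 : ContDiffOn ℝ (⊤ : ℕ∞) (deriv (deriv r)) J := hr1.deriv_of_isOpen hJ (by simp)
  have hd0 {s} (hs : s ∈ J) := hasDerivAt_deriv_of_contDiffOn hJ hr hs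
  have hd1 {s} (hs : s ∈ J) := hasDerivAt_deriv_of_contDiffOn hJ hr1 hs
  have hd2 {s} (hs : s ∈ J) := hasDerivAt_deriv_of_contDiffOn hJ hr2 hs
  have hrt : ∀ s ∈ J, r s ⬝ᵥ deriv r s = 0 := fun s hs => by
    have := hasDerivAt_zero_of_eqOn_const hJ hrs hs (hasDerivAt_dotProduct (hd0 hs) (hd0 hs))
    rw [dotProduct_comm] at this
    linarith
  have htq : ∀ s ∈ J, deriv r s ⬝ᵥ deriv (deriv r) s = 0 := fun s hs => by
    have := hasDerivAt_zero_of_eqOn_const hJ hra hs (hasDerivAt_dotProduct (hd1 hs) (hd1 hs))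
    rw [dotProduct_comm] at this
    linarith
  have hrq : ∀ s ∈ J, r s ⬝ᵥ deriv (deriv r) s = -1 := fun s hs => by
    have := hasDerivAt_zero_of_eqOn_const hJ hrt hs (hasDerivAt_dotProduct (hd0 hs) (hd1 hs))
    linarith [hra s hs]
  have hW1 : ∀ s ∈ J, deriv (tangentWedge r) s = wedge (emb (r s)) (emb (deriv (deriv r) s)) :=
    fun s hs => by
      have := hasDerivAt_wedge (hasDerivAt_emb (hd0 hs)) (hasDerivAt_emb (hd1 hs))
      rw [wedge_self, zero_add] at this
      exact this.deriv
  have hW2 : ∀ s ∈ J, deriv (deriv (tangentWedge r)) s =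
      wedge (emb (deriv r s)) (emb (deriv (deriv r) s)) +
        wedge (emb (r s)) (emb (deriv (deriv (deriv r)) s)) := fun s hs => by
    rw [(Filter.eventuallyEq_of_mem (hJ.mem_nhds hs) hW1).deriv_eq]
    exact (hasDerivAt_wedge (hasDerivAt_emb (hd0 hs)) (hasDerivAt_emb (hd2 hs))).deriv
  have hq : ∀ s ∈ J, deriv (deriv r) s = -r s := fun s hs => by
    have h := hm s hs
    rw [hW2 s hs, tangentWedge] at h
    exact eq_neg_of_wedge_eq_smul (hrs s hs) (hra s hs) (hrt s hs) (hrq s hs) (htq s hs) h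
  have hzero : Set.EqOn (deriv (tangentWedge r)) (fun _ => 0) J := fun s hs => by
    rw [hW1 s hs, hq s hs]
    ext i j
    fin_cases i <;> fin_cases j <;> simp [wedge, emb, mul_comm]
  have h := hm v hv
  rw [(Filter.eventuallyEq_of_mem (hJ.mem_nhds hv) hzero).deriv_eq, deriv_const] at h
  exact (smul_eq_zero.1 h.symm).resolve_right
    (wedge_emb_ne_zero (hrs v hv) (hra v hv) (hrt v hv))

lemma gaussG_eq_smul_tangentWedge {f g : ℝ → ℝ} (r : ℝ → Fin 3 → ℝ) {u : ℝ}
    (hg : deriv g u = 0) (v : ℝ) : gaussG f g r u v = deriv f u • tangentWedge r v := by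
  ext i j
  simp only [gaussG, tangentWedge, wedge, mx, my, hg, zero_smul, add_zero, Pi.smul_apply,
    smul_eq_mul]
  ring

/-- On a meridian surface with `g' ≡ 0` the Gauss map does not depend on `u`. -/
lemma surfLap_gaussG_of_deriv_eq_zero {I : Set ℝ} (hI : IsOpen I) {f g : ℝ → ℝ}
    (r : ℝ → Fin 3 → ℝ) (hf : ContDiffOn ℝ (⊤ : ℕ∞) f I)
    (hfg : ∀ u ∈ I, deriv f u ^ 2 + deriv g u ^ 2 = 1) (hg0 : ∀ u ∈ I, deriv g u = 0)
    {u : ℝ} (hu : u ∈ I) (v : ℝ) :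
    surfLap f (gaussG f g r) u v =
      -((1 / f u ^ 2) • deriv f u • deriv (deriv (tangentWedge r)) v) := by
  have hf1 : ContDiffOn ℝ (⊤ : ℕ∞) (deriv f) I := hf.deriv_of_isOpen hI (by simp)
  have hsq : ∀ s ∈ I, deriv f s ^ 2 = 1 := fun s hs => by simpa [hg0 s hs] using hfg s hs
  have hff : ∀ s ∈ I, deriv (deriv f) s = 0 := fun s hs => by
    have h := hasDerivAt_zero_of_eqOn_const hI hsq hs
      ((hasDerivAt_deriv_of_contDiffOn hI hf1 hs).pow 2)
    have hne : deriv f s ≠ 0 := fun h0 => by simpa [h0] using hsq s hs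
    simpa [hne] using h
  have hGu : Set.EqOn (deriv fun s => gaussG f g r s v) (fun _ => 0) I := fun s hs => by
    have he : (fun s => gaussG f g r s v) =ᶠ[nhds s] fun s => deriv f s • tangentWedge r v :=
      Filter.eventually_of_mem (hI.mem_nhds hs)
        fun x hx => gaussG_eq_smul_tangentWedge r (hg0 x hx) v
    have hd := (hasDerivAt_deriv_of_contDiffOn hI hf1 hs).smul_const (tangentWedge r v)
    rw [hff s hs, zero_smul] at hd
    exact he.deriv_eq.trans hd.deriv
  have hGv : (fun s => gaussG f g r u s) = deriv f u • tangentWedge r :=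
    funext fun s => gaussG_eq_smul_tangentWedge r (hg0 u hu) s
  have hGv' : deriv (deriv f u • tangentWedge r) = deriv f u • deriv (tangentWedge r) :=
    funext fun s => deriv_const_smul_field _ _
  rw [surfLap, hGu hu, (Filter.eventuallyEq_of_mem (hI.mem_nhds hu) hGu).deriv_eq, hGv, hGv',
    deriv_const_smul_field]
  simp

/-- If `g′ ≡ 0`, then there is no smooth nowhere-zero function `λ` with
`ΔG = λG`: there are no meridian surfaces with `g′ ≡ 0` having pointwise 1-type Gauss map
of the first kind. -/
theorem meridian_surface_no_first_kind_when_g_deriv_zero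
    (I J : Set ℝ) (hI : IsOpen I) (hIiv : I.OrdConnected) (hIne : I.Nonempty)
    (hJ : IsOpen J) (hJiv : J.OrdConnected) (hJne : J.Nonempty)
    (r : ℝ → Fin 3 → ℝ) (hr : ContDiffOn ℝ (⊤ : ℕ∞) r J)
    (hrs : ∀ v ∈ J, r v ⬝ᵥ r v = 1) (hra : ∀ v ∈ J, deriv r v ⬝ᵥ deriv r v = 1)
    (f g : ℝ → ℝ) (hf : ContDiffOn ℝ (⊤ : ℕ∞) f I) (hg : ContDiffOn ℝ (⊤ : ℕ∞) g I)
    (hf0 : ∀ u ∈ I, f u ≠ 0) (hfg : ∀ u ∈ I, deriv f u ^ 2 + deriv g u ^ 2 = 1)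
    (hg0 : ∀ u ∈ I, deriv g u = 0) :
    ¬ ∃ lam : ℝ → ℝ → ℝ,
        ContDiffOn ℝ (⊤ : ℕ∞) (Function.uncurry lam) (I ×ˢ J) ∧
        (∀ u ∈ I, ∀ v ∈ J, lam u v ≠ 0) ∧
        ∀ u ∈ I, ∀ v ∈ J, surfLap f (gaussG f g r) u v = lam u v • gaussG f g r u v := by
  rintro ⟨lam, -, hlam0, hlam⟩
  obtain ⟨u, hu⟩ := hIne
  obtain ⟨v, hv⟩ := hJne
  have hfu : deriv f u ≠ 0 := fun h0 => by simpa [h0, hg0 u hu] using hfg u hu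
  have hm : ∀ s ∈ J, deriv (deriv (tangentWedge r)) s =
      (-(f u ^ 2 * lam u s)) • tangentWedge r s := fun s hs => by
    have h := hlam u hu s hs
    rw [surfLap_gaussG_of_deriv_eq_zero hI r hf hfg hg0 hu,
      gaussG_eq_smul_tangentWedge r (hg0 u hu)] at h
    ext i j
    have hij := congrFun (congrFun h i) j
    simp only [Pi.neg_apply, Pi.smul_apply, smul_eq_mul] at hij ⊢
    have hf0u := hf0 u hu
    apply mul_left_cancel₀ hfu
    field_simp at hij
    linear_combination -deriv f u * hij
  have h := factor_eq_zero_of_deriv_deriv_tangentWedge hJ hr hrs hra hm hv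
  simp [hf0 u hu, hlam0 u hu v hv] at h
end
end
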